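/- arXiv:2202.12125 — 3 statements merged into one kernel-verified Lean document; each statement's English description precedes it below -/
import Mathlib

section
/- Let k ≥ 3 be a natural number and let x ∈ (0, 1/2]. Then (1-x)^2 > (1+x)(1-2x/3)^{2k}·(k^2 - 3(1-2x/3)^2)/(k^2 - 3). -/
lemma quintic_ge_two {y : ℝ} (h0 : 0 ≤ y) (h1 : y ≤ 1) :
    2 ≤ 4 + 4*y + 4*y^2 - 11*y^3 - 2*y^4 + 3*y^5 := by
  have h3 : y^3 ≤ 1 := pow_le_one₀ h0 h1
  have h4 : y^4 ≤ y := pow_le_of_le_one h0 h1 (by norm_num)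
  have hq : 0 ≤ 2 + 6*y + 10*y^2 - y^3 - 3*y^4 := by nlinarith [sq_nonneg y]
  nlinarith [mul_nonneg (sub_nonneg.2 h1) hq]

lemma cubic_pos {y : ℝ} (h : 2/3 ≤ y) : 0 < 2*y^3 + 4*y^2 - 5*y + 1 := by
  have h2 : 0 ≤ (y - 2/3)^2 := sq_nonneg _
  have h3 : 0 ≤ (y - 2/3)^3 := pow_nonneg (by linarith) _
  nlinarith

lemma mul_pow_six_lt {y : ℝ} (h : 2/3 ≤ y) (h1 : y < 1) :
    (5 - 3*y) * y^6 * (3 - y^2) < (3*y - 1)^2 := by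
  have hR := mul_le_mul_of_nonneg_left (quintic_ge_two (by linarith) h1.le)
    (pow_nonneg (by linarith : (0:ℝ) ≤ y) 3)
  have hQ : 0 < (1 - y) * (1 - 4*y) +
      y^3 * (4 + 4*y + 4*y^2 - 11*y^3 - 2*y^4 + 3*y^5) := by
    linarith [cubic_pos h]
  linarith [mul_pos (sub_pos.2 h1) hQ]

lemma sub_div_sub_le {a z : ℝ} (ha : 9 ≤ a) (hz : z ≤ 1) :
    (a - 3*z) / (a - 3) ≤ (3 - z) / 2 := by
  rw [div_le_div_iff₀ (by linarith) (by norm_num)]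
  nlinarith [mul_nonneg (sub_nonneg.2 ha) (sub_nonneg.2 hz)]

theorem ineq6 (k : ℕ) (hk : 3 ≤ k) (x : ℝ) (hx : x ∈ Set.Ioc (0 : ℝ) (1/2)) :
    (1 - x)^2 > (1 + x) * (1 - 2*x/3)^(2*k) * ((k:ℝ)^2 - 3 * (1 - 2*x/3)^2) / ((k:ℝ)^2 - 3) := by
  obtain ⟨hx0, hx1⟩ := hx
  obtain ⟨y, hy⟩ : ∃ y, y = 1 - 2*x/3 := ⟨_, rfl⟩
  rw [← hy]
  obtain rfl : x = 3*(1 - y)/2 := by linarith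
  have hy0 : 2/3 ≤ y := by linarith
  have hy1 : y < 1 := by linarith
  have hk' : (3:ℝ) ≤ k := by exact_mod_cast hk
  have hpow : y^(2*k) ≤ y^6 := pow_le_pow_of_le_one (by linarith) hy1.le (by omega)
  have hfrac := sub_div_sub_le (by nlinarith : (9:ℝ) ≤ (k:ℝ)^2) (by nlinarith : y^2 ≤ 1)
  have hnonneg : 0 ≤ (3 - y^2) / 2 := by nlinarith
  rw [gt_iff_lt, mul_div_assoc (_ * _)]
  calc (1 + 3*(1 - y)/2) * y^(2*k) * (((k:ℝ)^2 - 3*y^2) / ((k:ℝ)^2 - 3))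
      ≤ (1 + 3*(1 - y)/2) * y^(2*k) * ((3 - y^2) / 2) := by
        have : 0 ≤ y^(2*k) := pow_nonneg (by linarith) _
        exact mul_le_mul_of_nonneg_left hfrac (mul_nonneg (by linarith) this)
    _ ≤ (1 + 3*(1 - y)/2) * y^6 * ((3 - y^2) / 2) :=
        mul_le_mul_of_nonneg_right (mul_le_mul_of_nonneg_left hpow (by linarith)) hnonneg
    _ < (1 - 3*(1 - y)/2)^2 := by linarith [mul_pow_six_lt hy0 hy1]
end

section
/- For every τ ∈ (0, π/2) and every α ∈ (0, 1/2], one has G(τ,α) > 0. -/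
open Real

/-- G(τ,α) = (1+α)cos((3-2α)τ) + (3-α)cos((1-2α)τ) - (1-α)²cos(3τ) - (1+α)(3-α)cos(τ) -/
noncomputable def G (τ α : ℝ) : ℝ :=
  (1 + α) * Real.cos ((3 - 2*α) * τ) + (3 - α) * Real.cos ((1 - 2*α) * τ)
    - (1 - α)^2 * Real.cos (3 * τ) - (1 + α) * (3 - α) * Real.cos τ

/-- If a function vanishes at both ends of an interval on which it is differentiable, then its
derivative vanishes in between. -/
theorem exists_deriv_eq_zero_of_hasDerivAt_Icc {f f' : ℝ → ℝ} {a b : ℝ} (hab : a < b)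
    (hf : ∀ x ∈ Set.Icc a b, HasDerivAt f (f' x) x) (ha : f a = 0) (hb : f b = 0) :
    ∃ c ∈ Set.Ioo a b, f' c = 0 :=
  exists_hasDerivAt_eq_zero hab (fun x hx => (hf x hx).continuousAt.continuousWithinAt)
    (ha.trans hb.symm) fun x hx => hf x ⟨hx.1.le, hx.2.le⟩

/-- A function with four zeros has a zero of its third derivative between them. -/
theorem exists_third_deriv_eq_zero {f f₁ f₂ f₃ : ℝ → ℝ} {a b c d : ℝ}
    (hab : a < b) (hbc : b < c) (hcd : c < d)
    (h₁ : ∀ x ∈ Set.Icc a d, HasDerivAt f (f₁ x) x)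
    (h₂ : ∀ x ∈ Set.Icc a d, HasDerivAt f₁ (f₂ x) x)
    (h₃ : ∀ x ∈ Set.Icc a d, HasDerivAt f₂ (f₃ x) x)
    (ha : f a = 0) (hb : f b = 0) (hc : f c = 0) (hd : f d = 0) :
    ∃ ξ ∈ Set.Ioo a d, f₃ ξ = 0 := by
  obtain ⟨p, ⟨hp, hp'⟩, hp0⟩ := exists_deriv_eq_zero_of_hasDerivAt_Icc hab
    (fun x hx => h₁ x ⟨hx.1, by linarith [hx.2]⟩) ha hb
  obtain ⟨q, ⟨hq, hq'⟩, hq0⟩ := exists_deriv_eq_zero_of_hasDerivAt_Icc hbc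
    (fun x hx => h₁ x ⟨by linarith [hx.1], by linarith [hx.2]⟩) hb hc
  obtain ⟨r, ⟨hr, hr'⟩, hr0⟩ := exists_deriv_eq_zero_of_hasDerivAt_Icc hcd
    (fun x hx => h₁ x ⟨by linarith [hx.1], hx.2⟩) hc hd
  obtain ⟨s, ⟨hs, hs'⟩, hs0⟩ := exists_deriv_eq_zero_of_hasDerivAt_Icc (hp'.trans hq)
    (fun x hx => h₂ x ⟨by linarith [hx.1], by linarith [hx.2]⟩) hp0 hq0
  obtain ⟨t, ⟨ht, ht'⟩, ht0⟩ := exists_deriv_eq_zero_of_hasDerivAt_Icc (hq'.trans hr)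
    (fun x hx => h₂ x ⟨by linarith [hx.1], by linarith [hx.2]⟩) hq0 hr0
  obtain ⟨ξ, ⟨hξ, hξ'⟩, hξ0⟩ := exists_deriv_eq_zero_of_hasDerivAt_Icc (hs'.trans ht)
    (fun x hx => h₃ x ⟨by linarith [hx.1], by linarith [hx.2]⟩) hs0 ht0
  exact ⟨ξ, ⟨by linarith, by linarith⟩, hξ0⟩

/-- Cubic interpolation at four points, in Newton form. -/
theorem exists_cubic_interpolation (f : ℝ → ℝ) {a b c d : ℝ}
    (hab : a < b) (hbc : b < c) (hcd : c < d) :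
    ∃ p q r s : ℝ, ∀ x ∈ ({a, b, c, d} : Set ℝ), f x = p + q * (x - a) +
      r * ((x - a) * (x - b)) + s * ((x - a) * (x - b) * (x - c)) := by
  have hba : b - a ≠ 0 := by linarith
  have hca : (c - a) * (c - b) ≠ 0 := mul_ne_zero (by linarith) (by linarith)
  have hda : (d - a) * (d - b) * (d - c) ≠ 0 :=
    mul_ne_zero (mul_ne_zero (by linarith) (by linarith)) (by linarith)
  obtain ⟨q, hq⟩ : ∃ q, q * (b - a) = f b - f a := ⟨_, div_mul_cancel₀ _ hba⟩
  obtain ⟨r, hr⟩ : ∃ r, r * ((c - a) * (c - b)) = f c - f a - q * (c - a) :=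
    ⟨_, div_mul_cancel₀ _ hca⟩
  obtain ⟨s, hs⟩ : ∃ s, s * ((d - a) * (d - b) * (d - c)) =
      f d - f a - q * (d - a) - r * ((d - a) * (d - b)) := ⟨_, div_mul_cancel₀ _ hda⟩
  refine ⟨f a, q, r, s, ?_⟩
  rintro x (rfl | rfl | rfl | rfl)
  · ring
  · linear_combination -hq
  · linear_combination -hr
  · linear_combination -hs

/-- A four-point functional annihilating quadratics is a multiple of the third derivative at an
intermediate point. -/
theorem exists_four_point_eq_third_deriv {f f₁ f₂ f₃ : ℝ → ℝ} {a b c d u v w z : ℝ}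
    (hab : a < b) (hbc : b < c) (hcd : c < d)
    (h₁ : ∀ x ∈ Set.Icc a d, HasDerivAt f (f₁ x) x)
    (h₂ : ∀ x ∈ Set.Icc a d, HasDerivAt f₁ (f₂ x) x)
    (h₃ : ∀ x ∈ Set.Icc a d, HasDerivAt f₂ (f₃ x) x)
    (m₀ : u + v + w + z = 0) (m₁ : u * a + v * b + w * c + z * d = 0)
    (m₂ : u * a ^ 2 + v * b ^ 2 + w * c ^ 2 + z * d ^ 2 = 0) :
    ∃ ξ ∈ Set.Ioo a d, u * f a + v * f b + w * f c + z * f d =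
      z * ((d - a) * (d - b) * (d - c)) * (f₃ ξ / 6) := by
  obtain ⟨p, q, r, s, hf⟩ := exists_cubic_interpolation f hab hbc hcd
  have ha := hf a (by simp)
  have hb := hf b (by simp)
  have hc := hf c (by simp)
  have hd := hf d (by simp)
  have hx (e x : ℝ) : HasDerivAt (fun y : ℝ => y - e) 1 x := (hasDerivAt_id x).sub_const e
  obtain ⟨ξ, hξ, h⟩ := exists_third_deriv_eq_zero
    (f := fun x => f x - (p + q * (x - a) + r * ((x - a) * (x - b)) +
      s * ((x - a) * (x - b) * (x - c))))
    (f₁ := fun x => f₁ x - (q + r * ((x - a) + (x - b)) +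
      s * ((x - a) * (x - b) + ((x - a) + (x - b)) * (x - c))))
    (f₂ := fun x => f₂ x - (2 * r + 2 * s * ((x - a) + (x - b) + (x - c))))
    (f₃ := fun x => f₃ x - 6 * s) hab hbc hcd
    (fun x hI => by
      have hab' := (hx a x).mul (hx b x)
      refine ((h₁ x hI).sub (((((hx a x).const_mul q).const_add p).add (hab'.const_mul r)).add
        ((hab'.mul (hx c x)).const_mul s))).congr_deriv ?_
      simp only [Pi.mul_apply]
      ring)
    (fun x hI => by
      have hab' := (hx a x).mul (hx b x)
      have hs := (hx a x).add (hx b x)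
      refine ((h₂ x hI).sub (((hs.const_mul r).const_add q).add
        ((hab'.add (hs.mul (hx c x))).const_mul s))).congr_deriv ?_
      simp only [Pi.add_apply]
      ring)
    (fun x hI => by
      refine ((h₃ x hI).sub (((((hx a x).add (hx b x)).add (hx c x)).const_mul
        (2 * s)).const_add (2 * r))).congr_deriv ?_
      ring)
    (by linarith) (by linarith) (by linarith) (by linarith)
  refine ⟨ξ, hξ, ?_⟩
  have hs : f₃ ξ / 6 = s := by linarith
  rw [hs, ha, hb, hc, hd]
  linear_combination (p - q * a + r * a * b) * m₀ + (q - r * (a + b)) * m₁ + r * m₂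

/-- `sin z - z cos z` is positive on `(0, π]`. -/
theorem sin_sub_mul_cos_pos {z : ℝ} (h0 : 0 < z) (hπ : z ≤ π) : 0 < sin z - z * cos z := by
  have hd (x : ℝ) : HasDerivAt (fun x => sin x - x * cos x) (x * sin x) x := by
    refine ((hasDerivAt_sin x).sub ((hasDerivAt_id x).mul (hasDerivAt_cos x))).congr_deriv ?_
    simp only [id]
    ring
  have hm : StrictMonoOn (fun x => sin x - x * cos x) (Set.Icc 0 π) := by
    refine strictMonoOn_of_deriv_pos (convex_Icc 0 π)
      (fun x _ => (hd x).continuousAt.continuousWithinAt) fun x hx => ?_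
    rw [interior_Icc] at hx
    rw [(hd x).deriv]
    exact mul_pos hx.1 (sin_pos_of_pos_of_lt_pi hx.1 hx.2)
  simpa using hm ⟨le_rfl, pi_pos.le⟩ ⟨h0.le, hπ⟩ h0

/-- Positivity of the numerator of the spherical Bessel function `j₂` on `(0, 3π/2)`. -/
theorem spherical_bessel_two_numerator_pos {z : ℝ} (h0 : 0 < z) (h3 : z < 3 * (π / 2)) :
    0 < 3 * sin z - 3 * z * cos z - z ^ 2 * sin z := by
  have hπ3 := pi_gt_three
  rcases le_or_gt z π with hπ | hπ
  · have hd (x : ℝ) : HasDerivAt (fun x => 3 * sin x - 3 * x * cos x - x ^ 2 * sin x)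
        (x * (sin x - x * cos x)) x := by
      refine ((((hasDerivAt_sin x).const_mul 3).sub
        (((hasDerivAt_id x).const_mul 3).mul (hasDerivAt_cos x))).sub
        ((hasDerivAt_pow 2 x).mul (hasDerivAt_sin x))).congr_deriv ?_
      simp only [id]
      push_cast
      ring
    have hm : StrictMonoOn (fun x => 3 * sin x - 3 * x * cos x - x ^ 2 * sin x)
        (Set.Icc 0 π) := by
      refine strictMonoOn_of_deriv_pos (convex_Icc 0 π)
        (fun x _ => (hd x).continuousAt.continuousWithinAt) fun x hx => ?_
      rw [interior_Icc] at hx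
      rw [(hd x).deriv]
      exact mul_pos hx.1 (sin_sub_mul_cos_pos hx.1 hx.2.le)
    simpa using hm ⟨le_rfl, pi_pos.le⟩ ⟨h0.le, hπ⟩ h0
  · have hc : cos z < 0 := cos_neg_of_pi_div_two_lt_of_lt (by linarith) (by linarith)
    have hs : 0 ≤ sin (z - π) := sin_nonneg_of_nonneg_of_le_pi (by linarith) (by linarith)
    rw [sin_sub_pi] at hs
    nlinarith [mul_pos h0 (neg_pos.mpr hc), mul_nonneg hs (by nlinarith : 0 ≤ z ^ 2 - 3)]

theorem hasDerivAt_cos_mul_sqrt (τ : ℝ) {x : ℝ} (hx : 0 < x) :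
    HasDerivAt (fun x => cos (τ * √x)) (-(τ * sin (τ * √x)) / (2 * √x)) x := by
  have hs := (hasDerivAt_sqrt hx.ne').const_mul τ
  refine hs.cos.congr_deriv ?_
  ring

theorem hasDerivAt_second_cos_mul_sqrt (τ : ℝ) {x : ℝ} (hx : 0 < x) :
    HasDerivAt (fun x => -(τ * sin (τ * √x)) / (2 * √x))
      ((τ * sin (τ * √x) - τ ^ 2 * √x * cos (τ * √x)) / (4 * √x ^ 3)) x := by
  have h := hasDerivAt_sqrt hx.ne'
  have h0 : √x ≠ 0 := (sqrt_pos.mpr hx).ne'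
  refine ((((h.const_mul τ).sin.const_mul τ).neg).div (h.const_mul 2)
    (mul_ne_zero two_ne_zero h0)).congr_deriv ?_
  simp only [Pi.neg_apply]
  field_simp
  ring

theorem hasDerivAt_third_cos_mul_sqrt (τ : ℝ) {x : ℝ} (hx : 0 < x) :
    HasDerivAt (fun x => (τ * sin (τ * √x) - τ ^ 2 * √x * cos (τ * √x)) / (4 * √x ^ 3))
      (-τ * (3 * sin (τ * √x) - 3 * (τ * √x) * cos (τ * √x) -
        (τ * √x) ^ 2 * sin (τ * √x)) / (8 * √x ^ 5)) x := by
  have h := hasDerivAt_sqrt hx.ne'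
  have h0 : √x ≠ 0 := (sqrt_pos.mpr hx).ne'
  refine ((((h.const_mul τ).sin.const_mul τ).sub ((h.const_mul (τ ^ 2)).mul
    (h.const_mul τ).cos)).div ((h.pow 3).const_mul 4)
    (mul_ne_zero four_ne_zero (pow_ne_zero 3 h0))).congr_deriv ?_
  simp only [Pi.sub_apply, Pi.mul_apply, Pi.pow_apply]
  field_simp
  push_cast
  ring

theorem G_one_half (τ : ℝ) : G τ (1 / 2) = (1 - cos τ) ^ 3 := by
  have h2 : (3 - 2 * (1 / 2 : ℝ)) * τ = 2 * τ := by ring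
  have h0 : (1 - 2 * (1 / 2 : ℝ)) * τ = 0 := by ring
  rw [G, h2, h0, cos_two_mul, cos_three_mul, cos_zero]
  ring

theorem G_pos (τ : ℝ) (hτ : τ ∈ Set.Ioo 0 (π/2)) (α : ℝ) (hα : α ∈ Set.Ioc (0 : ℝ) (1/2)) :
    G τ α > 0 := by
  obtain ⟨hτ0, hτ1⟩ := hτ
  obtain ⟨hα0, hα1⟩ := hα
  rcases hα1.eq_or_lt with rfl | hα1
  · have hc : cos τ < 1 := by
      simpa using cos_lt_cos_of_nonneg_of_le_pi_div_two le_rfl hτ1.le hτ0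
    rw [G_one_half]
    exact pow_pos (sub_pos.mpr hc) 3
  have hb : 0 < (1 - 2 * α) ^ 2 := pow_pos (by linarith) 2
  obtain ⟨ξ, ⟨hξ, hξ9⟩, h⟩ := exists_four_point_eq_third_deriv
    (a := (1 - 2 * α) ^ 2) (b := 1 ^ 2) (c := (3 - 2 * α) ^ 2) (d := 3 ^ 2)
    (u := 3 - α) (v := -((1 + α) * (3 - α))) (w := 1 + α) (z := -(1 - α) ^ 2)
    (by nlinarith) (by nlinarith) (by nlinarith)
    (fun x hx => hasDerivAt_cos_mul_sqrt τ (hb.trans_le hx.1))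
    (fun x hx => hasDerivAt_second_cos_mul_sqrt τ (hb.trans_le hx.1))
    (fun x hx => hasDerivAt_third_cos_mul_sqrt τ (hb.trans_le hx.1))
    (by ring) (by ring) (by ring)
  have hξ0 : 0 < √ξ := sqrt_pos.mpr (hb.trans hξ)
  have hξ3 : √ξ < 3 := (sqrt_lt' three_pos).mpr hξ9
  have hz : 0 < τ * √ξ := mul_pos hτ0 hξ0
  have hN := spherical_bessel_two_numerator_pos hz (by nlinarith)
  rw [sqrt_sq (by linarith), sqrt_sq zero_le_one, sqrt_sq (by linarith),
    sqrt_sq zero_le_three] at h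
  have hG : G τ α = (1 - α) ^ 2 * ((3 ^ 2 - (1 - 2 * α) ^ 2) * (3 ^ 2 - 1 ^ 2) *
      (3 ^ 2 - (3 - 2 * α) ^ 2)) * (τ * (3 * sin (τ * √ξ) - 3 * (τ * √ξ) * cos (τ * √ξ) -
        (τ * √ξ) ^ 2 * sin (τ * √ξ)) / (8 * √ξ ^ 5) / 6) := by
    rw [G, mul_comm (3 - 2 * α) τ, mul_comm (1 - 2 * α) τ, mul_comm 3 τ]
    rw [mul_one] at h
    linear_combination h
  have h1 : 0 < 1 - α := by linarith
  have h2 : (0 : ℝ) < 3 ^ 2 - (1 - 2 * α) ^ 2 := by nlinarith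
  have h3 : (0 : ℝ) < 3 ^ 2 - (3 - 2 * α) ^ 2 := by nlinarith
  have h4 : (0 : ℝ) < 3 ^ 2 - 1 ^ 2 := by norm_num
  rw [hG]
  positivity
end

section
/- Let T ≥ 1 be a natural number. The complex polynomial map S^{(T)}(z) = z + (2(1+T)/(1+2T))·sin(π/(2+2T))·z^{T+1} + (1/(1+2T))·z^{2T+1} is injective on the open unit disk {z ∈ ℂ : |z| < 1}. -/
open Real

/-- The extremal T-fold symmetric trinomial
S^{(T)}(z) = z + (2(1+T)/(1+2T))·sin(π/(2+2T))·z^{T+1} + (1/(1+2T))·z^{2T+1}. -/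
noncomputable def suffridgeTrinomial (T : ℕ) (z : ℂ) : ℂ :=
  z + ((2 * (1 + (T:ℝ)) / (1 + 2*(T:ℝ)) * Real.sin (π / (2 + 2*(T:ℝ))) : ℝ) : ℂ) * z^(T+1)
    + ((1 / (1 + 2*(T:ℝ)) : ℝ) : ℂ) * z^(2*T+1)

open Filter Topology

section Univalence

/-- A strictly differentiable function with nonzero derivative separates nearby points. -/
theorem HasStrictDerivAt.eventually_eq_imp_eq {f : ℂ → ℂ} {f' z : ℂ}
    (hf : HasStrictDerivAt f f' z) (h0 : f' ≠ 0) :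
    ∀ᶠ p : ℂ × ℂ in 𝓝 (z, z), f p.1 = f p.2 → p.1 = p.2 := by
  have hpos : 0 < ‖f'‖ / 2 := by positivity
  filter_upwards [hf.isLittleO.def hpos] with p hp heq
  by_contra hne
  have hn : 0 < ‖p.1 - p.2‖ := norm_pos_iff.2 (sub_ne_zero.2 hne)
  simp [heq] at hp
  nlinarith [norm_pos_iff.2 h0, mul_pos (norm_pos_iff.2 h0) hn]

/-- A holomorphic function on the unit disk with nonvanishing derivative which is injective on
every circle centered at the origin is injective. -/
theorem injOn_ball_of_injOn_circles {f f' : ℂ → ℂ}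
    (hf : ∀ z ∈ Metric.ball (0 : ℂ) 1, HasStrictDerivAt f (f' z) z)
    (hf' : ∀ z ∈ Metric.ball (0 : ℂ) 1, f' z ≠ 0)
    (hcirc : ∀ z w : ℂ, ‖z‖ < 1 → ‖z‖ = ‖w‖ → f z = f w → z = w) :
    Set.InjOn f (Metric.ball (0 : ℂ) 1) := by
  intro z₀ hz₀ w₀ hw₀ heq₀
  by_contra hne₀
  simp only [mem_ball_zero_iff] at hz₀ hw₀ hf hf'
  set R := max ‖z₀‖ ‖w₀‖ with hR
  have hR1 : R < 1 := max_lt hz₀ hw₀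
  set P : Set (ℂ × ℂ) := Metric.closedBall 0 R ×ˢ Metric.closedBall 0 R with hP
  have hPc : IsCompact P := (isCompact_closedBall _ _).prod (isCompact_closedBall _ _)
  set K : Set (ℂ × ℂ) := {p | p ∈ P ∧ f p.1 = f p.2 ∧ p.1 ≠ p.2} with hK
  have hP1 : ∀ p ∈ P, ‖p.1‖ ≤ R ∧ ‖p.2‖ ≤ R := fun p hp => by simpa [hP] using hp
  have hKcl : IsClosed K := by
    refine isClosed_of_closure_subset fun p hp => ?_
    have hpP : p ∈ P := closure_minimal (fun q hq => hq.1) hPc.isClosed hp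
    have hfr := mem_closure_iff_frequently.1 hp
    obtain ⟨h1, h2⟩ := hP1 p hpP
    refine ⟨hpP, ?_, ?_⟩
    · by_contra hne
      have c1 : ContinuousAt (fun q : ℂ × ℂ => f q.1 - f q.2) p :=
        ((hf p.1 (by linarith)).hasDerivAt.continuousAt.comp continuousAt_fst).sub
          ((hf p.2 (by linarith)).hasDerivAt.continuousAt.comp continuousAt_snd)
      obtain ⟨q, hq, hq'⟩ :=
        (hfr.and_eventually (c1.eventually_ne (sub_ne_zero.2 hne))).exists
      exact hq' (sub_eq_zero.2 hq.2.1)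
    · intro hdiag
      have hev := (hf p.1 (by linarith)).eventually_eq_imp_eq (hf' p.1 (by linarith))
      have hpp : (p.1, p.1) = p := Prod.ext rfl hdiag
      rw [hpp] at hev
      obtain ⟨q, hq, hq'⟩ := (hfr.and_eventually hev).exists
      exact hq.2.2 (hq' hq.2.1)
  have hKc : IsCompact K := hPc.of_isClosed_subset hKcl fun q hq => hq.1
  have hKne : K.Nonempty := ⟨(z₀, w₀), by simp [hP, hR], heq₀, hne₀⟩
  obtain ⟨p, hpK, hmin⟩ := hKc.exists_isMinOn hKne
    (f := fun q : ℂ × ℂ => max ‖q.1‖ ‖q.2‖) (by fun_prop)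
  -- a pair with different moduli can be moved inwards by the open mapping property
  have key : ∀ z w : ℂ, ‖w‖ < ‖z‖ → ‖z‖ ≤ R → f z = f w →
      ∃ z' w' : ℂ, ‖z'‖ < ‖z‖ ∧ ‖w'‖ < ‖z'‖ ∧ f z' = f w' := by
    intro z w hwz hzR heq
    have hz0 : 0 < ‖z‖ := (norm_nonneg w).trans_lt hwz
    obtain ⟨m, hm1, hm2⟩ := exists_between hwz
    have hmap := (hf w (by linarith)).map_nhds_eq (hf' w (by linarith))
    have hU : {v : ℂ | ‖v‖ < m} ∈ 𝓝 w :=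
      (isOpen_lt continuous_norm continuous_const).mem_nhds hm1
    have himg : f '' {v : ℂ | ‖v‖ < m} ∈ 𝓝 (f z) := by
      rw [heq, ← hmap]; exact image_mem_map hU
    have hcz := (hf z (by linarith)).hasDerivAt.continuousAt.eventually_mem himg
    have hct : ContinuousAt (fun t : ℝ => (t : ℂ) * z) 1 := by fun_prop
    have e1 : ∀ᶠ t : ℝ in 𝓝 1, f ((t : ℂ) * z) ∈ f '' {v : ℂ | ‖v‖ < m} := by
      have hcz' : ∀ᶠ v in 𝓝 (((1 : ℝ) : ℂ) * z), f v ∈ f '' {v : ℂ | ‖v‖ < m} := by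
        simpa using hcz
      exact hct.eventually hcz'
    have e2 : ∀ᶠ t : ℝ in 𝓝 1, m < ‖(t : ℂ) * z‖ := by
      refine hct.norm.eventually_const_lt ?_
      simpa using hm2
    have e3 : ∀ᶠ t : ℝ in 𝓝[<] 1, 0 < t ∧ t < 1 :=
      Ioo_mem_nhdsLT (by norm_num)
    obtain ⟨t, ⟨⟨v, hv, hfv⟩, ht2⟩, ht0, ht1⟩ :=
      (((e1.and e2).filter_mono nhdsWithin_le_nhds).and e3).exists
    refine ⟨(t : ℂ) * z, v, ?_, lt_trans hv ht2, hfv.symm⟩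
    rw [norm_mul, Complex.norm_real, Real.norm_of_nonneg ht0.le]
    nlinarith
  obtain ⟨hpP, hpeq, hpne⟩ := hpK
  obtain ⟨h1, h2⟩ := hP1 p hpP
  have mem : ∀ z w : ℂ, ‖z‖ ≤ R → ‖w‖ < ‖z‖ → f z = f w → (z, w) ∈ K := by
    intro z w hz hw heq
    refine ⟨by simpa [hP] using ⟨hz, hw.le.trans hz⟩, heq, fun h => ?_⟩
    exact hw.ne (congrArg norm (show z = w from h)).symm
  have mono : ∀ z w : ℂ, ‖w‖ < ‖z‖ → ‖z‖ ≤ R → f z = f w → max ‖p.1‖ ‖p.2‖ < ‖z‖ := by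
    intro z w hwz hzR heq
    obtain ⟨z', w', hz', hw', heq'⟩ := key z w hwz hzR heq
    have := hmin (mem z' w' (hz'.le.trans hzR) hw' heq')
    simp only [Set.mem_ofPred_eq, max_eq_left hw'.le] at this
    exact this.trans_lt hz'
  rcases lt_trichotomy ‖p.1‖ ‖p.2‖ with h | h | h
  · exact absurd (mono p.2 p.1 h h2 hpeq.symm) (not_lt.2 (le_max_right _ _))
  · exact hpne (hcirc _ _ (by linarith) h hpeq)
  · exact absurd (mono p.1 p.2 h h1 hpeq) (not_lt.2 (le_max_left _ _))

end Univalence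

/-- A real quadratic `1 + A u + B u²` with `|B| ≤ 1` and `|A| ≤ 1 + B` has no zero in the open
unit disk. -/
theorem one_add_quadratic_ne_zero {A B : ℝ} (hB : |B| ≤ 1) (hA : |A| ≤ 1 + B) {u : ℂ}
    (hu : ‖u‖ < 1) : 1 + (A : ℂ) * u + (B : ℂ) * u ^ 2 ≠ 0 := by
  intro h
  have hre := congrArg Complex.re h
  have him := congrArg Complex.im h
  simp [pow_two] at hre him
  have hn : u.re ^ 2 + u.im ^ 2 < 1 := by
    have := Complex.sq_norm u
    rw [Complex.normSq_apply] at this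
    nlinarith [norm_nonneg u]
  obtain ⟨hB1, hB2⟩ := abs_le.1 hB
  obtain ⟨hA1, hA2⟩ := abs_le.1 hA
  have hfac : u.im * (A + 2 * B * u.re) = 0 := by linarith
  rcases mul_eq_zero.1 hfac with hy | hAx
  · rw [hy] at hre hn
    have hx : |u.re| < 1 := by
      rw [← sq_lt_one_iff_abs_lt_one]; linarith
    obtain ⟨hx1, hx2⟩ := abs_lt.1 hx
    rcases le_total 0 u.re with hx0 | hx0
    · nlinarith [mul_pos (sub_pos.2 hx2) (show 0 < 1 - B * u.re by nlinarith)]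
    · nlinarith [mul_pos (show 0 < 1 + u.re by linarith) (show 0 < 1 + B * u.re by nlinarith)]
  · have : A = -(2 * B * u.re) := by linarith
    subst this
    nlinarith [sq_nonneg u.re, sq_nonneg u.im]

theorem Real.abs_sin_nat_mul_le_mul_abs_sin (n : ℕ) (x : ℝ) :
    |sin (n * x)| ≤ n * |sin x| := by
  induction n with
  | zero => simp
  | succ k ih =>
    have h : sin (((k + 1 : ℕ) : ℝ) * x) = sin (k * x) * cos x + cos (k * x) * sin x := by
      rw [← sin_add]; push_cast; ring_nf
    rw [h]
    refine (abs_add_le _ _).trans ?_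
    rw [abs_mul, abs_mul]
    push_cast
    nlinarith [abs_cos_le_one x, abs_cos_le_one (k * x), abs_nonneg (sin x),
      abs_nonneg (sin (k * x)), abs_nonneg (cos x), abs_nonneg (cos (k * x))]

section TrigInequality

theorem hasDerivAt_sin_div_sin_add_cos (N : ℕ) {x : ℝ} (hx : sin (N * x) ≠ 0) :
    HasDerivAt (fun y : ℝ => (N - 1) * (sin y / sin (N * y)) + cos ((N - 1) * y))
      ((N - 1) * (cos (N * x) * (sin ((2 * N - 1) * x) - (2 * N - 1) * sin x) / 2
        / sin (N * x) ^ 2)) x := by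
  have h1 : HasDerivAt (fun y : ℝ => sin (N * y)) (cos (N * x) * N) x :=
    (hasDerivAt_sin _).comp x (by simpa using (hasDerivAt_id x).const_mul (N : ℝ))
  have h2 : HasDerivAt (fun y : ℝ => cos ((N - 1) * y)) (-sin ((N - 1) * x) * (N - 1)) x :=
    (hasDerivAt_cos _).comp x (by simpa using (hasDerivAt_id x).const_mul ((N : ℝ) - 1))
  refine ((((hasDerivAt_sin x).div h1 hx).const_mul ((N : ℝ) - 1)).add h2).congr_deriv ?_
  have e1 : sin (((N : ℝ) - 1) * x) = sin (N * x) * cos x - cos (N * x) * sin x := by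
    rw [← sin_sub]; ring_nf
  have e2 : sin ((2 * (N : ℝ) - 1) * x)
      = 2 * sin (N * x) * cos (N * x) * cos x - (1 - 2 * sin (N * x) ^ 2) * sin x := by
    rw [show (2 * (N : ℝ) - 1) * x = 2 * (N * x) - x by ring, sin_sub, sin_two_mul, cos_two_mul,
      cos_sq']
    ring
  rw [e1, e2]
  field_simp
  have := cos_sq' (N * x)
  linear_combination ((2 - 2 * N) * sin (N * x) * cos x) * this

theorem sin_two_mul_sub_one_le {N : ℕ} (hN : 2 ≤ N) {x : ℝ} (h0 : 0 ≤ sin x) :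
    |sin ((2 * N - 1) * x)| ≤ (2 * N - 1) * sin x := by
  have := abs_sin_nat_mul_le_mul_abs_sin (2 * N - 1) x
  rw [abs_of_nonneg h0] at this
  rw [Nat.cast_sub (by omega)] at this
  push_cast at this
  exact this

theorem nat_mul_sin_le_sin_div_sin_add_cos {N : ℕ} (hN : 2 ≤ N) {x : ℝ} (hx0 : 0 < x)
    (hx : x < π / N) :
    N * sin (π / (2 * N)) ≤ (N - 1) * (sin x / sin (N * x)) + cos ((N - 1) * x) := by
  set g : ℝ → ℝ := fun y : ℝ => (N - 1) * (sin y / sin (N * y)) + cos ((N - 1) * y) with hg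
  have hN2 : (2 : ℝ) ≤ N := by exact_mod_cast hN
  have hNpos : (0 : ℝ) < N := by linarith
  have hπ := pi_pos
  set d := π / (2 * N) with hd
  have hd0 : 0 < d := by positivity
  have hNd : N * d = π / 2 := by rw [hd]; field_simp
  have hdx : π / N = 2 * d := by rw [hd]; field_simp
  have hgd : g d = N * sin d := by
    have : ((N : ℝ) - 1) * d = π / 2 - d := by linarith
    simp only [hg]
    rw [hNd, this, sin_pi_div_two, cos_pi_div_two_sub]
    ring
  have hsin : ∀ y, 0 < y → y < 2 * d → 0 < sin (N * y) := fun y h1 h2 =>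
    sin_pos_of_pos_of_lt_pi (by positivity) (by nlinarith)
  have hder : ∀ y, 0 < y → y < 2 * d → HasDerivAt g _ y := fun y h1 h2 =>
    hasDerivAt_sin_div_sin_add_cos N (hsin y h1 h2).ne'
  have hfac : ∀ y, 0 < y → y < 2 * d →
      sin ((2 * N - 1) * y) - (2 * N - 1) * sin y ≤ 0 := fun y h1 h2 => by
    have hs : 0 ≤ sin y := sin_nonneg_of_nonneg_of_le_pi h1.le (by nlinarith)
    linarith [(abs_le.1 (sin_two_mul_sub_one_le hN hs)).2]
  rw [← hgd]
  change g d ≤ g x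
  rw [hdx] at hx
  rcases le_total x d with hxd | hxd
  · refine antitoneOn_of_deriv_nonpos (convex_Icc x d) ?_ ?_ ?_ ⟨le_rfl, hxd⟩ ⟨hxd, le_rfl⟩ hxd
    · exact fun y hy => (hder y (by linarith [hy.1])
        (by linarith [hy.2])).continuousAt.continuousWithinAt
    · rw [interior_Icc]
      exact fun y hy => (hder y (by linarith [hy.1])
        (by linarith [hy.2])).differentiableAt.differentiableWithinAt
    · rw [interior_Icc]
      intro y hy
      have hy0 : 0 < y := by linarith [hy.1]
      have hy2 : y < 2 * d := by linarith [hy.2]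
      rw [(hder y hy0 hy2).deriv]
      have hc : 0 ≤ cos (N * y) := cos_nonneg_of_mem_Icc ⟨by nlinarith, by nlinarith [hy.2]⟩
      have := mul_nonpos_of_nonneg_of_nonpos hc (hfac y hy0 hy2)
      exact mul_nonpos_of_nonneg_of_nonpos (by linarith)
        (div_nonpos_of_nonpos_of_nonneg (by linarith) (sq_nonneg _))
  · refine monotoneOn_of_deriv_nonneg (convex_Icc d x) ?_ ?_ ?_ ⟨le_rfl, hxd⟩ ⟨hxd, le_rfl⟩ hxd
    · exact fun y hy => (hder y (by linarith [hy.1])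
        (by linarith [hy.2])).continuousAt.continuousWithinAt
    · rw [interior_Icc]
      exact fun y hy => (hder y (by linarith [hy.1])
        (by linarith [hy.2])).differentiableAt.differentiableWithinAt
    · rw [interior_Icc]
      intro y hy
      have hy0 : 0 < y := by linarith [hy.1]
      have hy2 : y < 2 * d := by linarith [hy.2]
      rw [(hder y hy0 hy2).deriv]
      have hc : cos (N * y) ≤ 0 :=
        cos_nonpos_of_pi_div_two_le_of_le (by nlinarith [hy.1]) (by nlinarith)
      have := mul_nonneg_of_nonpos_of_nonpos hc (hfac y hy0 hy2)
      exact mul_nonneg (by linarith) (div_nonneg (by linarith) (sq_nonneg _))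

theorem two_mul_nat_mul_sin_mul_abs_sin_le_of_le_pi_div_two {N : ℕ} (hN : 2 ≤ N) {x : ℝ}
    (hx0 : 0 < x) (hx : x ≤ π / 2) :
    2 * N * sin (π / (2 * N)) * |sin (N * x)| ≤ (2 * N - 1) * sin x + sin ((2 * N - 1) * x) := by
  have hN2 : (2 : ℝ) ≤ N := by exact_mod_cast hN
  have hNpos : (0 : ℝ) < N := by linarith
  have hπ := pi_pos
  have hsx : 0 ≤ sin x := sin_nonneg_of_nonneg_of_le_pi hx0.le (by linarith)
  rcases lt_or_ge x (π / N) with hlt | hge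
  · have h := nat_mul_sin_le_sin_div_sin_add_cos hN hx0 hlt
    have hs : 0 < sin (N * x) :=
      sin_pos_of_pos_of_lt_pi (by positivity) (by rw [lt_div_iff₀ hNpos] at hlt; linarith)
    have h' := mul_le_mul_of_nonneg_right h hs.le
    have e : ((N - 1) * (sin x / sin (N * x)) + cos ((N - 1) * x)) * sin (N * x)
        = (N - 1) * sin x + sin (N * x) * cos ((N - 1) * x) := by
      field_simp
    rw [e] at h'
    have e2 : 2 * (sin (N * x) * cos ((N - 1) * x)) = sin ((2 * N - 1) * x) + sin x := by
      have a1 : (2 * (N : ℝ) - 1) * x = N * x + (N - 1) * x := by ring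
      have a2 : sin x = sin (N * x - (N - 1) * x) := by ring_nf
      rw [a1, a2, sin_add, sin_sub]; ring
    rw [abs_of_pos hs]
    linarith
  · rcases hN.eq_or_lt with rfl | hN3
    · have hxe : x = π / 2 := le_antisymm hx (by simpa using hge)
      have h1 := neg_one_le_sin (((2 : ℝ) * (2 : ℕ) - 1) * x)
      have h2 : sin (((2 : ℕ) : ℝ) * x) = 0 := by
        rw [hxe, show ((2 : ℕ) : ℝ) * (π / 2) = π by push_cast; ring, sin_pi]
      have h3 : sin x = 1 := by rw [hxe, sin_pi_div_two]
      rw [h2, h3]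
      simp only [abs_zero, mul_zero]
      push_cast at h1 ⊢
      linarith
    · have hN3' : (3 : ℝ) ≤ N := by exact_mod_cast hN3
      set d := π / (2 * N) with hd
      have hd0 : 0 < d := by positivity
      have hNd : N * d = π / 2 := by rw [hd]; field_simp
      have hdx : π / N = 2 * d := by rw [hd]; field_simp
      have hd6 : d ≤ π / 6 := by nlinarith
      have hpi3 := pi_gt_three
      have hpi4 := pi_lt_d2
      have hs0 : 0 < sin d := sin_pos_of_pos_of_lt_pi hd0 (by linarith)
      have hs1 : d - d ^ 3 / 6 < sin d := sin_gt_sub_cube hd0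
      have hs2 : 0.93 * d ≤ sin d := by
        nlinarith [mul_le_mul hd6 hd6 hd0.le (by linarith), mul_pos hd0 hd0]
      have hNs : 1.39 ≤ N * sin d := by nlinarith
      have hc : 0.86 ≤ cos d := by
        have : cos (π / 6) ≤ cos d := cos_le_cos_of_nonneg_of_le_pi hd0.le (by linarith) hd6
        rw [cos_pi_div_six] at this
        have h3 : (1.72 : ℝ) ≤ √3 := by
          apply Real.le_sqrt_of_sq_le; norm_num
        linarith
      have hsd : 2 * sin d * cos d ≤ sin x := by
        rw [← sin_two_mul]
        exact sin_le_sin_of_le_of_le_pi_div_two (by linarith) hx (by linarith)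
      have h1 := neg_one_le_sin ((2 * (N : ℝ) - 1) * x)
      have habs := abs_sin_le_one (N * x)
      have hL : 2 * N * sin d * |sin (N * x)| ≤ 2 * N * sin d :=
        mul_le_of_le_one_right (by positivity) habs
      have hR : (2 * N - 1) * (2 * sin d * 0.86) ≤ (2 * N - 1) * sin x := by
        refine mul_le_mul_of_nonneg_left ?_ (by linarith)
        nlinarith
      nlinarith

theorem two_mul_nat_mul_sin_mul_abs_sin_le {N : ℕ} (hN : 2 ≤ N) {x : ℝ}
    (hx0 : 0 < x) (hx : x < π) :
    2 * N * sin (π / (2 * N)) * |sin (N * x)| ≤ (2 * N - 1) * sin x + sin ((2 * N - 1) * x) := by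
  rcases le_total x (π / 2) with h | h
  · exact two_mul_nat_mul_sin_mul_abs_sin_le_of_le_pi_div_two hN hx0 h
  · have key := two_mul_nat_mul_sin_mul_abs_sin_le_of_le_pi_div_two hN
      (x := π - x) (by linarith) (by linarith)
    have e1 : |sin (N * (π - x))| = |sin (N * x)| := by
      rw [mul_sub, sin_sub, sin_nat_mul_pi, zero_mul, zero_sub, abs_neg, abs_mul,
        cos_nat_mul_pi, abs_neg_one_pow, one_mul]
    have e2 : sin ((2 * N - 1) * (π - x)) = sin ((2 * N - 1) * x) := by
      rw [show (2 * (N : ℝ) - 1) * (π - x) = (π - (2 * N - 1) * x) + ((N : ℤ) - 1 : ℤ) * (2 * π) by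
        push_cast; ring, sin_add_int_mul_two_pi, sin_pi_sub]
    rwa [e1, e2, sin_pi_sub] at key

theorem nat_sq_mul_sin_pi_div_le {N : ℕ} (hN : 2 ≤ N) :
    (N : ℝ) ^ 2 * sin (π / (2 * N)) ≤ 2 * N - 1 := by
  have hpi4 := pi_lt_d2
  rcases hN.eq_or_lt with rfl | hN3
  · have h2 : √2 ≤ 1.5 := by
      rw [Real.sqrt_le_left (by norm_num)]; norm_num
    rw [show π / (2 * ((2 : ℕ) : ℝ)) = π / 4 by push_cast; ring, sin_pi_div_four]
    push_cast
    linarith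
  · have hN3' : (3 : ℝ) ≤ N := by exact_mod_cast hN3
    have h := sin_le (x := π / (2 * N)) (by positivity)
    calc (N : ℝ) ^ 2 * sin (π / (2 * N)) ≤ N ^ 2 * (π / (2 * N)) := by gcongr
      _ = N * π / 2 := by field_simp
      _ ≤ 2 * N - 1 := by nlinarith

end TrigInequality

/-- Two distinct points on a common circle are `ρ e^{iφ}` and `ρ e^{-iφ}` with `0 < φ < π`. -/
theorem exists_eq_mul_exp_of_norm_eq {z w : ℂ} (h : ‖z‖ = ‖w‖) (hne : z ≠ w) :
    ∃ (ρ : ℂ) (φ : ℝ), 0 < φ ∧ φ < π ∧ ‖ρ‖ = ‖z‖ ∧ ρ ≠ 0 ∧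
      z = ρ * Complex.exp (φ * Complex.I) ∧ w = ρ * Complex.exp (-(φ * Complex.I)) := by
  have hw : w ≠ 0 := by
    rintro rfl
    exact hne (norm_eq_zero.1 (by simpa using h))
  have hn : ‖z / w‖ = 1 := by rw [norm_div, h, div_self (norm_ne_zero_iff.2 hw)]
  set θ := toIcoMod two_pi_pos 0 (Complex.arg (z / w)) with hθ
  have hexp : Complex.exp (θ * Complex.I) = z / w := by
    have h1 := Complex.norm_mul_exp_arg_mul_I (z / w)
    rw [hn, Complex.ofReal_one, one_mul] at h1
    rw [← h1, Complex.exp_eq_exp_iff_exists_int]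
    refine ⟨-toIcoDiv two_pi_pos 0 (Complex.arg (z / w)), ?_⟩
    rw [hθ, toIcoMod]
    rw [zsmul_eq_mul]
    push_cast
    ring
  have hmem := toIcoMod_mem_Ico two_pi_pos 0 (Complex.arg (z / w))
  rw [← hθ, zero_add] at hmem
  have hθ0 : θ ≠ 0 := by
    intro h0
    rw [h0] at hexp
    simp at hexp
    exact hne ((div_eq_one_iff_eq hw).1 hexp.symm)
  have hθpos : 0 < θ := lt_of_le_of_ne hmem.1 hθ0.symm
  refine ⟨w * Complex.exp ((θ / 2 : ℝ) * Complex.I), θ / 2, by linarith, by linarith [hmem.2],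
    ?_, mul_ne_zero hw (Complex.exp_ne_zero _), ?_, ?_⟩
  · rw [norm_mul, Complex.norm_exp_ofReal_mul_I, mul_one, h]
  · rw [mul_assoc, ← Complex.exp_add,
      show ((θ / 2 : ℝ) : ℂ) * Complex.I + (θ / 2 : ℝ) * Complex.I = θ * Complex.I by
        push_cast; ring, hexp]
    field_simp
  · rw [mul_assoc, ← Complex.exp_add]; simp

theorem mul_exp_pow_sub_mul_exp_pow (ρ : ℂ) (φ : ℝ) (n : ℕ) :
    (ρ * Complex.exp (φ * Complex.I)) ^ n - (ρ * Complex.exp (-(φ * Complex.I))) ^ n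
      = 2 * Complex.I * (ρ ^ n * (sin (n * φ) : ℝ)) := by
  rw [mul_pow, mul_pow, ← Complex.exp_nat_mul, ← Complex.exp_nat_mul]
  rw [show (n : ℂ) * (φ * Complex.I) = ((n * φ : ℝ) : ℂ) * Complex.I by push_cast; ring,
    show (n : ℂ) * -(φ * Complex.I) = -((n * φ : ℝ) : ℂ) * Complex.I by push_cast; ring,
    Complex.exp_mul_I, Complex.exp_mul_I, Complex.cos_neg, Complex.sin_neg, Complex.ofReal_sin]
  ring

theorem suffridgeTrinomial_eq_of_norm_eq {T : ℕ} (hT : 1 ≤ T) {z w : ℂ} (hz : ‖z‖ < 1)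
    (hzw : ‖z‖ = ‖w‖) (heq : suffridgeTrinomial T z = suffridgeTrinomial T w) : z = w := by
  by_contra hne
  obtain ⟨ρ, φ, hφ0, hφπ, hρ, hρ0, rfl, rfl⟩ := exists_eq_mul_exp_of_norm_eq hzw hne
  have hs : 0 < sin φ := sin_pos_of_pos_of_lt_pi hφ0 hφπ
  have hN : 2 ≤ T + 1 := by omega
  have hT0 : (0 : ℝ) < 1 + 2 * T := by positivity
  have hmain := two_mul_nat_mul_sin_mul_abs_sin_le hN hφ0 hφπ
  have hb := sin_two_mul_sub_one_le hN hs.le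
  have c1 : 2 * ((T + 1 : ℕ) : ℝ) - 1 = 1 + 2 * T := by push_cast; ring
  have c2 : 2 * ((T + 1 : ℕ) : ℝ) = 2 + 2 * T := by push_cast; ring
  rw [c1, c2] at hmain
  rw [c1] at hb
  set s := sin (π / (2 + 2 * (T : ℝ))) with hsdef
  have hs0 : 0 ≤ s := sin_nonneg_of_nonneg_of_le_pi (by positivity)
    (div_le_self pi_pos.le (by linarith))
  set SN := sin (((T + 1 : ℕ) : ℝ) * φ) with hSN
  set S2 := sin ((1 + 2 * (T : ℝ)) * φ) with hS2
  set a : ℝ := 2 * (1 + (T:ℝ)) / (1 + 2*(T:ℝ)) * s with ha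
  set b : ℝ := 1 / (1 + 2*(T:ℝ)) with hbdef
  have hu : ‖ρ ^ T‖ < 1 := by
    rw [norm_pow]
    exact pow_lt_one₀ (norm_nonneg _) (by rw [hρ]; exact hz) (by omega)
  refine one_add_quadratic_ne_zero (A := a * SN / sin φ) (B := b * S2 / sin φ) ?_ ?_ hu ?_
  · rw [hbdef, abs_div, abs_of_pos hs, div_le_one hs, abs_mul, abs_of_pos (by positivity),
      one_div, inv_mul_le_iff₀ hT0]
    exact hb
  · rw [abs_div, abs_of_pos hs, abs_mul, abs_of_nonneg (a := a) (by positivity),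
      div_le_iff₀ hs, add_mul, div_mul_cancel₀ _ hs.ne', one_mul, ha, hbdef]
    rw [show 2 * (1 + (T:ℝ)) / (1 + 2*(T:ℝ)) * s * |SN| = (2 + 2 * T) * s * |SN| / (1 + 2 * T) by
      ring, div_le_iff₀ hT0]
    have e : (sin φ + 1 / (1 + 2 * (T : ℝ)) * S2) * (1 + 2 * T) = (1 + 2 * T) * sin φ + S2 := by
      field_simp
    linarith
  · have h1 := mul_exp_pow_sub_mul_exp_pow ρ φ 1
    have h2 := mul_exp_pow_sub_mul_exp_pow ρ φ (T + 1)
    have h3 := mul_exp_pow_sub_mul_exp_pow ρ φ (2 * T + 1)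
    have e3 : (((2 * T + 1 : ℕ) : ℝ) * φ) = (1 + 2 * (T : ℝ)) * φ := by push_cast; ring
    rw [e3, ← hS2] at h3
    rw [← hSN] at h2
    rw [pow_one, pow_one, pow_one, Nat.cast_one, one_mul] at h1
    have heq0 := sub_eq_zero.2 heq
    simp only [suffridgeTrinomial, ← hsdef, ← ha, ← hbdef] at heq0
    have hsum : 2 * Complex.I * ρ * (sin φ + a * SN * ρ ^ T + b * S2 * (ρ ^ T) ^ 2 : ℂ) = 0 := by
      have p3 : ρ ^ (2 * T + 1) = ρ * (ρ ^ T) ^ 2 := by ring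
      have p2 : ρ ^ (T + 1) = ρ * ρ ^ T := by ring
      rw [p3] at h3
      rw [p2] at h2
      linear_combination heq0 - h1 - a * h2 - b * h3
    have hsC : ((sin φ : ℝ) : ℂ) ≠ 0 := by exact_mod_cast hs.ne'
    have h0 := (mul_eq_zero.1 hsum).resolve_left
      (mul_ne_zero (mul_ne_zero two_ne_zero Complex.I_ne_zero) hρ0)
    push_cast at h0 hsC ⊢
    field_simp
    linear_combination h0

theorem suffridgeTrinomial_injOn (T : ℕ) (hT : 1 ≤ T) :
    Set.InjOn (suffridgeTrinomial T) (Metric.ball (0 : ℂ) 1) := by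
  have hT0 : (0 : ℝ) < 1 + 2 * T := by positivity
  set s := sin (π / (2 + 2 * (T : ℝ))) with hs
  have hs0 : 0 ≤ s := sin_nonneg_of_nonneg_of_le_pi (by positivity)
    (div_le_self pi_pos.le (by linarith))
  set a : ℝ := 2 * (1 + (T:ℝ)) / (1 + 2*(T:ℝ)) * s with ha
  refine injOn_ball_of_injOn_circles
    (f' := fun z => 1 + (((T + 1) * a : ℝ) : ℂ) * z ^ T + ((1 : ℝ) : ℂ) * (z ^ T) ^ 2) ?_ ?_
    fun z w hz hzw heq => suffridgeTrinomial_eq_of_norm_eq hT hz hzw heq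
  · intro z _
    have h1 := (hasStrictDerivAt_id z).add
      ((hasStrictDerivAt_pow (T + 1) z).const_mul (a : ℂ))
    have h2 := h1.add ((hasStrictDerivAt_pow (2 * T + 1) z).const_mul
      ((1 / (1 + 2*(T:ℝ)) : ℝ) : ℂ))
    refine h2.congr_deriv ?_
    have hT0' : (1 + 2 * (T : ℂ)) ≠ 0 := by exact_mod_cast hT0.ne'
    simp only [Nat.add_sub_cancel]
    push_cast
    have hinv := mul_inv_cancel₀ hT0'
    rw [one_div]
    linear_combination z ^ (2 * T) * hinv
  · intro z hz
    have hz1 : ‖z‖ < 1 := by simpa using hz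
    refine one_add_quadratic_ne_zero (by simp) ?_
      (by rw [norm_pow]; exact pow_lt_one₀ (norm_nonneg _) hz1 (by omega))
    have h := nat_sq_mul_sin_pi_div_le (N := T + 1) (by omega)
    have c2 : 2 * ((T + 1 : ℕ) : ℝ) = 2 + 2 * T := by push_cast; ring
    rw [c2, ← hs] at h
    push_cast at h
    rw [abs_of_nonneg (by positivity), ha,
      show ((T : ℝ) + 1) * (2 * (1 + (T:ℝ)) / (1 + 2*(T:ℝ)) * s)
        = 2 * ((T + 1) ^ 2 * s) / (1 + 2 * T) by ring, div_le_iff₀ hT0]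
    linarith
end
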